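/- Let h ≠ 0 be real and let x₁, x₂ be real. Then for all real y one has exp_h(x₁ ⊖^h x₂, y) = exp_h(x₁, y) · exp_h(x₂, −y), where x₁ ⊖^h x₂ = x₁·√(1+h²x₂²) − x₂·√(1+h²x₁²). In particular exp_h(−x, y) = exp_h(x, −y) for all real x, y. -/

import Mathlib

theorem aux_pos (h x : ℝ) : 0 < Real.sqrt (1 + h ^ 2 * x ^ 2) + h * x ∧
    0 < Real.sqrt (1 + h ^ 2 * x ^ 2) - h * x := by
  have h1 : |h * x| < Real.sqrt (1 + h ^ 2 * x ^ 2) := by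
    apply Real.lt_sqrt_of_sq_lt
    rw [sq_abs, mul_pow]
    linarith
  have := abs_lt.mp h1
  constructor <;> linarith [this.1, this.2]

theorem aux_neg (h x y : ℝ) : (h * x + Real.sqrt (1 + h ^ 2 * x ^ 2)) ^ ((-y) / h) =
    (Real.sqrt (1 + h ^ 2 * x ^ 2) - h * x) ^ (y / h) := by
  obtain ⟨p, q⟩ := aux_pos h x
  have hs : Real.sqrt (1 + h ^ 2 * x ^ 2) ^ 2 = 1 + h ^ 2 * x ^ 2 :=
    Real.sq_sqrt (by positivity)
  have e : Real.sqrt (1 + h ^ 2 * x ^ 2) - h * x =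
      (h * x + Real.sqrt (1 + h ^ 2 * x ^ 2))⁻¹ := by
    apply eq_inv_of_mul_eq_one_left
    linear_combination hs
  rw [e, neg_div, Real.rpow_neg (by linarith), Real.inv_rpow (by linarith)]

/-- `exp_h(x₁ ⊖^h x₂, y) = exp_h(x₁,y) · exp_h(x₂,−y)` with
`x₁ ⊖^h x₂ = x₁·√(1+h²x₂²) − x₂·√(1+h²x₁²)`; in particular
`exp_h(−x,y) = exp_h(x,−y)`. -/
theorem kaniadakis_exp_ominus (h : ℝ) (hh : h ≠ 0) :
    (∀ x₁ x₂ y : ℝ,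
      (h * (x₁ * Real.sqrt (1 + h ^ 2 * x₂ ^ 2) - x₂ * Real.sqrt (1 + h ^ 2 * x₁ ^ 2)) +
          Real.sqrt (1 + h ^ 2 *
            (x₁ * Real.sqrt (1 + h ^ 2 * x₂ ^ 2) - x₂ * Real.sqrt (1 + h ^ 2 * x₁ ^ 2)) ^ 2))
        ^ (y / h) =
      (h * x₁ + Real.sqrt (1 + h ^ 2 * x₁ ^ 2)) ^ (y / h) *
        (h * x₂ + Real.sqrt (1 + h ^ 2 * x₂ ^ 2)) ^ ((-y) / h)) ∧
    (∀ x y : ℝ,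
      (h * (-x) + Real.sqrt (1 + h ^ 2 * (-x) ^ 2)) ^ (y / h) =
        (h * x + Real.sqrt (1 + h ^ 2 * x ^ 2)) ^ ((-y) / h)) := by
  constructor
  · intro x₁ x₂ y
    rw [aux_neg]
    obtain ⟨p₁, q₁⟩ := aux_pos h x₁
    obtain ⟨p₂, q₂⟩ := aux_pos h x₂
    have hA : Real.sqrt (1 + h ^ 2 * x₁ ^ 2) ^ 2 = 1 + h ^ 2 * x₁ ^ 2 :=
      Real.sq_sqrt (by positivity)
    have hB : Real.sqrt (1 + h ^ 2 * x₂ ^ 2) ^ 2 = 1 + h ^ 2 * x₂ ^ 2 :=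
      Real.sq_sqrt (by positivity)
    rw [← Real.mul_rpow (by linarith) q₂.le]
    generalize Real.sqrt (1 + h ^ 2 * x₁ ^ 2) = A at *
    generalize Real.sqrt (1 + h ^ 2 * x₂ ^ 2) = B at *
    have e : 1 + h ^ 2 * (x₁ * B - x₂ * A) ^ 2 = (A * B - h * x₁ * (h * x₂)) ^ 2 := by
      linear_combination (-B ^ 2 + h ^ 2 * x₂ ^ 2) * hA - hB
    have hp : 0 ≤ A * B - h * x₁ * (h * x₂) := by
      nlinarith [mul_pos p₁ q₂, mul_pos q₁ p₂]
    rw [e, Real.sqrt_sq hp]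
    congr 1
    ring
  · intro x y
    rw [aux_neg, neg_sq]
    congr 1
    ring
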